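/- Let a, b > 0, ν > 0 and N ∈ ℕ. Then (1+ν)a − νb + (1+ν)·S_N( 1/(1+ν); a^{1+ν} b^{−ν}, b ) ≤ a^{1+ν} b^{−ν}. -/

import Mathlib

open Real Finset

noncomputable def kj (j : ℕ) (ν : ℝ) : ℤ := ⌊(2:ℝ)^(j-1) * ν⌋

noncomputable def rj (j : ℕ) (ν : ℝ) : ℤ := ⌊(2:ℝ)^j * ν⌋

noncomputable def sj (j : ℕ) (ν : ℝ) : ℝ :=
  (-1:ℝ)^(rj j ν) * (2:ℝ)^(j-1) * ν
    + (-1:ℝ)^(rj j ν + 1) * (⌊((rj j ν : ℝ) + 1)/2⌋ : ℤ)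

noncomputable def SS (N : ℕ) (ν a b : ℝ) : ℝ :=
  ∑ j ∈ Finset.Icc 1 N, sj j ν *
    ((b ^ ((2:ℝ)^(j-1) - (kj j ν : ℝ)) * a ^ ((kj j ν : ℝ))) ^ ((1:ℝ)/2^j)
      - (a ^ ((kj j ν : ℝ) + 1) * b ^ ((2:ℝ)^(j-1) - (kj j ν : ℝ) - 1)) ^ ((1:ℝ)/2^j))^2

/-- The weighted geometric mean `a ^ x * b ^ (1 - x)`, written in terms of `p = log a` and
`q = log b`. -/
noncomputable def geomPath (p q x : ℝ) : ℝ := Real.exp (x * p + (1 - x) * q)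

/-- The value at `μ` of the piecewise linear interpolation of `geomPath p q` at the dyadic
points of level `n`. -/
noncomputable def dyadicInterp (p q μ : ℝ) (n : ℕ) : ℝ :=
  (1 - (2 ^ n * μ - ⌊(2:ℝ) ^ n * μ⌋)) * geomPath p q (⌊(2:ℝ) ^ n * μ⌋ / 2 ^ n)
    + (2 ^ n * μ - ⌊(2:ℝ) ^ n * μ⌋) * geomPath p q ((⌊(2:ℝ) ^ n * μ⌋ + 1) / 2 ^ n)

lemma geomPath_le_dyadicInterp (p q μ : ℝ) (n : ℕ) :
    geomPath p q μ ≤ dyadicInterp p q μ n := by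
  have h2 : (0:ℝ) < 2 ^ n := by positivity
  have ht1 : 0 ≤ 1 - (2 ^ n * μ - ⌊(2:ℝ) ^ n * μ⌋) := by
    linarith [Int.lt_floor_add_one ((2:ℝ) ^ n * μ)]
  have ht0 : 0 ≤ 2 ^ n * μ - ⌊(2:ℝ) ^ n * μ⌋ := by
    linarith [Int.floor_le ((2:ℝ) ^ n * μ)]
  have h := convexOn_exp.2 (Set.mem_univ ((⌊(2:ℝ) ^ n * μ⌋ / 2 ^ n : ℝ) * p
      + (1 - (⌊(2:ℝ) ^ n * μ⌋ / 2 ^ n : ℝ)) * q))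
    (Set.mem_univ (((⌊(2:ℝ) ^ n * μ⌋ + 1) / 2 ^ n : ℝ) * p
      + (1 - ((⌊(2:ℝ) ^ n * μ⌋ + 1) / 2 ^ n : ℝ)) * q))
    ht1 ht0 (sub_add_cancel _ _)
  simp only [smul_eq_mul] at h
  refine le_trans (le_of_eq ?_) h
  unfold geomPath
  congr 1
  field_simp
  ring

lemma dyadicInterp_zero {p q μ : ℝ} (h0 : 0 ≤ μ) (h1 : μ < 1) :
    dyadicInterp p q μ 0 = μ * Real.exp p + (1 - μ) * Real.exp q := by
  have hf : ⌊μ⌋ = 0 := Int.floor_eq_zero_iff.2 ⟨h0, h1⟩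
  simp [dyadicInterp, geomPath, hf]
  ring

lemma rpow_mul_rpow_rpow_eq_exp {a b : ℝ} (ha : 0 < a) (hb : 0 < b) (x y z : ℝ) :
    (a ^ x * b ^ y) ^ z = Real.exp ((x * Real.log a + y * Real.log b) * z) := by
  rw [Real.rpow_def_of_pos ha, Real.rpow_def_of_pos hb, ← Real.exp_add, ← Real.exp_mul]
  ring_nf

lemma dyadicInterp_succ {a b : ℝ} (ha : 0 < a) (hb : 0 < b) (μ : ℝ) (n : ℕ) :
    sj (n + 1) μ *
      ((b ^ ((2:ℝ)^n - (kj (n + 1) μ : ℝ)) * a ^ ((kj (n + 1) μ : ℝ))) ^ ((1:ℝ)/2^(n + 1))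
      - (a ^ ((kj (n + 1) μ : ℝ) + 1) * b ^ ((2:ℝ)^n - (kj (n + 1) μ : ℝ) - 1))
        ^ ((1:ℝ)/2^(n + 1)))^2
      + dyadicInterp (Real.log a) (Real.log b) μ (n + 1)
      = dyadicInterp (Real.log a) (Real.log b) μ n := by
  rw [rpow_mul_rpow_rpow_eq_exp hb ha, rpow_mul_rpow_rpow_eq_exp ha hb]
  unfold dyadicInterp sj kj rj geomPath
  simp only [Nat.add_sub_cancel]
  generalize Real.log a = p
  generalize Real.log b = q
  have hx : (2:ℝ) ^ (n + 1) * μ = 2 * (2 ^ n * μ) := by ring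
  have hxn (c : ℝ) : c * (2:ℝ) ^ n * μ = c * (2 ^ n * μ) := by ring
  rw [hx, hxn]
  have h2 : (2:ℝ) ^ n ≠ 0 := by positivity
  have hk1 := Int.floor_le ((2:ℝ) ^ n * μ)
  have hk2 := Int.lt_floor_add_one ((2:ℝ) ^ n * μ)
  generalize (2:ℝ) ^ n * μ = x at *
  generalize ⌊x⌋ = k at *
  set u := Real.exp (((2 ^ n - (k:ℝ)) * q + k * p) * (1 / 2 ^ (n + 1))) with hu
  set v := Real.exp (((k + 1 : ℝ) * p + (2 ^ n - (k:ℝ) - 1) * q) * (1 / 2 ^ (n + 1))) with hv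
  have hP : Real.exp ((k:ℝ) / 2 ^ n * p + (1 - (k:ℝ) / 2 ^ n) * q) = u * u := by
    rw [hu, ← Real.exp_add]
    congr 1
    rw [pow_succ]
    field_simp
    ring
  have hQ : Real.exp (((k:ℝ) + 1) / 2 ^ n * p + (1 - ((k:ℝ) + 1) / 2 ^ n) * q) = v * v := by
    rw [hv, ← Real.exp_add]
    congr 1
    rw [pow_succ]
    field_simp
    ring
  have hM : Real.exp ((2 * (k:ℝ) + 1) / 2 ^ (n + 1) * p
      + (1 - (2 * (k:ℝ) + 1) / 2 ^ (n + 1)) * q) = u * v := by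
    rw [hu, hv, ← Real.exp_add]
    congr 1
    rw [pow_succ]
    field_simp
    ring
  have hdiv (c : ℝ) : 2 * c / 2 ^ (n + 1) = c / 2 ^ n := by
    rw [pow_succ]
    field_simp
  rw [hP, hQ]
  rcases lt_or_ge (2 * x) (2 * k + 1) with h | h
  · have hr : ⌊2 * x⌋ = 2 * k := by
      rw [Int.floor_eq_iff]
      push_cast
      constructor <;> linarith
    have hm : ⌊(((2 * k : ℤ) : ℝ) + 1) / 2⌋ = k := by
      rw [Int.floor_eq_iff]
      push_cast
      constructor <;> linarith
    have hs : (-1:ℝ) ^ (2 * k) = 1 := (even_two_mul k).neg_one_zpow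
    rw [hr, hm, zpow_add₀ (by norm_num), hs]
    push_cast
    rw [hM, hdiv, hP]
    ring
  · have hr : ⌊2 * x⌋ = 2 * k + 1 := by
      rw [Int.floor_eq_iff]
      push_cast
      constructor <;> linarith
    have hm : ⌊(((2 * k + 1 : ℤ) : ℝ) + 1) / 2⌋ = k + 1 := by
      rw [Int.floor_eq_iff]
      push_cast
      constructor <;> linarith
    have hs : (-1:ℝ) ^ (2 * k + 1) = -1 := (odd_two_mul_add_one k).neg_one_zpow
    rw [hr, hm, zpow_add₀ (by norm_num) (2 * k + 1), hs]
    push_cast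
    rw [hM, show 2 * (k:ℝ) + 1 + 1 = 2 * (k + 1) by ring, hdiv, hQ]
    ring

lemma SS_add_dyadicInterp {a b : ℝ} (ha : 0 < a) (hb : 0 < b) (μ : ℝ) (N : ℕ) :
    SS N μ a b + dyadicInterp (Real.log a) (Real.log b) μ N
      = dyadicInterp (Real.log a) (Real.log b) μ 0 := by
  induction N with
  | zero => simp [SS]
  | succ n ih =>
    rw [← ih, ← dyadicInterp_succ ha hb μ n]
    unfold SS
    rw [Finset.sum_Icc_succ_top (by omega)]
    simp only [Nat.add_sub_cancel]
    ring

/-- Refined weighted arithmetic-geometric mean inequality. -/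
lemma rpow_mul_rpow_add_SS_le {a b μ : ℝ} (ha : 0 < a) (hb : 0 < b) (h0 : 0 ≤ μ) (h1 : μ < 1)
    (N : ℕ) : a ^ μ * b ^ (1 - μ) + SS N μ a b ≤ μ * a + (1 - μ) * b := by
  have h := SS_add_dyadicInterp ha hb μ N
  rw [dyadicInterp_zero h0 h1, Real.exp_log ha, Real.exp_log hb] at h
  have h' := geomPath_le_dyadicInterp (Real.log a) (Real.log b) μ N
  have hg : a ^ μ * b ^ (1 - μ) = geomPath (Real.log a) (Real.log b) μ := by
    rw [geomPath, Real.exp_add, Real.rpow_def_of_pos ha, Real.rpow_def_of_pos hb,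
      mul_comm μ, mul_comm (1 - μ)]
  linarith

theorem stmt5 (a b ν : ℝ) (ha : 0 < a) (hb : 0 < b) (hν : 0 < ν) (N : ℕ) :
    (1 + ν) * a - ν * b + (1 + ν) * SS N (1/(1 + ν)) (a ^ (1 + ν) * b ^ (-ν)) b
      ≤ a ^ (1 + ν) * b ^ (-ν) := by
  have hν1 : 0 < 1 + ν := by linarith
  have hA : 0 < a ^ (1 + ν) * b ^ (-ν) := by positivity
  have h := rpow_mul_rpow_add_SS_le hA hb (μ := 1 / (1 + ν)) (by positivity)
    (by rw [div_lt_one hν1]; linarith) N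
  have hga : (a ^ (1 + ν) * b ^ (-ν)) ^ (1 / (1 + ν)) * b ^ (1 - 1 / (1 + ν)) = a := by
    rw [rpow_mul_rpow_rpow_eq_exp ha hb, Real.rpow_def_of_pos hb, ← Real.exp_add]
    refine Eq.trans (congrArg Real.exp ?_) (Real.exp_log ha)
    field_simp
    ring
  rw [hga] at h
  have h3 := mul_le_mul_of_nonneg_left h hν1.le
  have h4 : (1 + ν) * (1 / (1 + ν) * (a ^ (1 + ν) * b ^ (-ν)) + (1 - 1 / (1 + ν)) * b)
      = a ^ (1 + ν) * b ^ (-ν) + ν * b := by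
    field_simp
    ring
  linarith
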